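/- Let α ∈ (0,1), T > 0, and let φ : [0,T] → ℝ be continuous. For x ∈ [0,T] define the left Riemann–Liouville fractional integral I^α_{0+}φ(x) = (1/Γ(α)) ∫₀^x (x−y)^{α−1} φ(y) dy. Fix t ∈ (0,T). Then, as h ↓ 0, h^{−α} ( I^α_{0+}φ(t+h) − I^α_{0+}φ(t) ) converges to c_α · φ(t), where c_α = (1/Γ(α)) [ ∫₀^{+∞} ((y+1)^{α−1} − y^{α−1}) dy + ∫₀^1 y^{α−1} dy ], and this constant c_α is finite (the integral ∫₀^{+∞} ((y+1)^{α−1} − y^{α−1}) dy is absolutely convergent). -/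

import Mathlib

open MeasureTheory Filter Real

noncomputable section

/-- The left Riemann–Liouville fractional integral of order `α` of `φ`. -/
def riemannLiouville (α : ℝ) (φ : ℝ → ℝ) (x : ℝ) : ℝ :=
  (1 / Real.Gamma α) * ∫ y in (0 : ℝ)..x, (x - y) ^ (α - 1) * φ y

theorem rpow_sub_rpow_add_one_nonneg {α v : ℝ} (hα : α ≤ 1) (hv : 0 < v) :
    0 ≤ v ^ (α - 1) - (v + 1) ^ (α - 1) :=
  sub_nonneg.2 (Real.rpow_le_rpow_of_nonpos hv (by linarith) (by linarith))

theorem tendsto_rpow_add_one_sub_rpow_atTop {α : ℝ} (hα : α ∈ Set.Ioo (0 : ℝ) 1) :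
    Tendsto (fun v : ℝ => (v + 1) ^ α - v ^ α) atTop (nhds 0) := by
  have hlim : Tendsto (fun v : ℝ => α * v ^ (α - 1)) atTop (nhds 0) := by
    have h := (tendsto_rpow_neg_atTop (y := 1 - α) (by linarith [hα.2])).const_mul α
    simpa using h
  refine tendsto_of_tendsto_of_tendsto_of_le_of_le' tendsto_const_nhds hlim ?_ ?_
  · filter_upwards [eventually_gt_atTop 0] with v hv
    exact sub_nonneg.2 (Real.rpow_le_rpow hv.le (by linarith) hα.1.le)
  · filter_upwards [eventually_gt_atTop 0] with v hv
    have hfac : v + 1 = v * (1 + 1 / v) := by field_simp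
    have hbern : (1 + 1 / v) ^ α ≤ 1 + α * (1 / v) :=
      rpow_one_add_le_one_add_mul_self (by have : 0 < 1 / v := by positivity
                                           linarith) hα.1.le hα.2.le
    have hmul := mul_le_mul_of_nonneg_left hbern (Real.rpow_nonneg hv.le α)
    rw [hfac, Real.mul_rpow hv.le (by positivity), Real.rpow_sub_one hv.ne']
    calc v ^ α * (1 + 1 / v) ^ α - v ^ α ≤ v ^ α * (1 + α * (1 / v)) - v ^ α := by linarith
      _ = α * (v ^ α / v) := by ring

theorem integrableOn_rpow_add_one_sub_rpow {α : ℝ} (hα : α ∈ Set.Ioo (0 : ℝ) 1) :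
    IntegrableOn (fun y : ℝ => (y + 1) ^ (α - 1) - y ^ (α - 1)) (Set.Ioi 0) volume := by
  have hα0 : α ≠ 0 := hα.1.ne'
  have hpos : IntegrableOn (fun y : ℝ => y ^ (α - 1) - (y + 1) ^ (α - 1)) (Set.Ioi 0) volume := by
    refine integrableOn_Ioi_deriv_of_nonneg (g := fun v : ℝ => -(α⁻¹ * ((v + 1) ^ α - v ^ α)))
      (l := -(α⁻¹ * 0)) ?_ ?_ (fun v hv => rpow_sub_rpow_add_one_nonneg hα.2.le hv)
      ((tendsto_rpow_add_one_sub_rpow_atTop hα).const_mul _).neg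
    · refine Continuous.continuousWithinAt ?_
      have h1 : Continuous fun v : ℝ => v ^ α := Real.continuous_rpow_const hα.1.le
      have h2 : Continuous fun v : ℝ => (v + 1) ^ α := h1.comp (continuous_id.add continuous_const)
      fun_prop
    · intro v hv
      have hv : 0 < v := hv
      have h1 : HasDerivAt (fun v : ℝ => v ^ α) (α * v ^ (α - 1)) v :=
        Real.hasDerivAt_rpow_const (Or.inl hv.ne')
      have h2 : HasDerivAt (fun v : ℝ => (v + 1) ^ α) (α * (v + 1) ^ (α - 1)) v :=
        (Real.hasDerivAt_rpow_const (Or.inl (by linarith : v + 1 ≠ 0))).comp_add_const v 1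
      refine ((h2.sub h1).const_mul α⁻¹).neg.congr_deriv ?_
      rw [← mul_sub, inv_mul_cancel_left₀ hα0, neg_sub]
  exact hpos.neg.congr_fun (fun y _ => neg_sub _ _) measurableSet_Ioi

theorem rpow_neg_mul_integral_sub_rpow_mul (α : ℝ) (ψ : ℝ → ℝ) {h x : ℝ} (hh : 0 < h)
    (hx : 0 ≤ x) :
    h ^ (-α) * ∫ y in (0 : ℝ)..x, (x - y) ^ (α - 1) * ψ y =
      ∫ u in (0 : ℝ)..x / h, u ^ (α - 1) * ψ (x - h * u) := by
  have hsub := intervalIntegral.integral_comp_sub_mul (a := 0) (b := x / h)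
    (fun y => (x - y) ^ (α - 1) * ψ y) hh.ne' x
  rw [mul_div_cancel₀ x hh.ne', sub_self, mul_zero, sub_zero, smul_eq_mul] at hsub
  have hscale : ∫ u in (0 : ℝ)..x / h, (x - (x - h * u)) ^ (α - 1) * ψ (x - h * u) =
      h ^ (α - 1) * ∫ u in (0 : ℝ)..x / h, u ^ (α - 1) * ψ (x - h * u) := by
    rw [← intervalIntegral.integral_const_mul]
    refine intervalIntegral.integral_congr fun u hu => ?_
    rw [Set.uIcc_of_le (by positivity)] at hu
    simp only [sub_sub_cancel]
    rw [Real.mul_rpow hh.le hu.1, mul_assoc]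
  rw [hscale, Real.rpow_sub_one hh.ne'] at hsub
  have hne := (Real.rpow_pos_of_pos hh α).ne'
  rw [Real.rpow_neg hh.le]
  field_simp at hsub ⊢
  exact hsub.symm

theorem intervalIntegrable_rpow_mul_comp {α : ℝ} (hα : 0 < α) {ψ : ℝ → ℝ} (hψ : Continuous ψ)
    (x h a b : ℝ) :
    IntervalIntegrable (fun u : ℝ => u ^ (α - 1) * ψ (x - h * u)) volume a b :=
  (intervalIntegral.intervalIntegrable_rpow' (by linarith)).mul_continuousOn
    (by fun_prop : Continuous fun u => ψ (x - h * u)).continuousOn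

theorem rpow_neg_mul_integral_sub_integral {α : ℝ} (hα : 0 < α) {ψ : ℝ → ℝ} (hψ : Continuous ψ)
    {h t : ℝ} (hh : 0 < h) (ht : 0 ≤ t) :
    h ^ (-α) * ((∫ y in (0 : ℝ)..t + h, (t + h - y) ^ (α - 1) * ψ y) -
        ∫ y in (0 : ℝ)..t, (t - y) ^ (α - 1) * ψ y) =
      (∫ v in (0 : ℝ)..t / h, ((v + 1) ^ (α - 1) - v ^ (α - 1)) * ψ (t - h * v)) +
        ∫ u in (0 : ℝ)..1, u ^ (α - 1) * ψ (t + h - h * u) := by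
  have hint := intervalIntegrable_rpow_mul_comp hα hψ
  have hshift := intervalIntegral.integral_comp_add_right (a := 0) (b := t / h)
    (fun u => u ^ (α - 1) * ψ (t + h - h * u)) 1
  have hshift_int := ((hint (t + h) h 1 (t / h + 1)).comp_add_right 1)
  have harg : ∀ v : ℝ, t + h - h * (v + 1) = t - h * v := fun v => by ring
  simp only [harg, zero_add, sub_self, add_sub_cancel_right] at hshift hshift_int
  rw [mul_sub, rpow_neg_mul_integral_sub_rpow_mul α ψ hh (by positivity),
    rpow_neg_mul_integral_sub_rpow_mul α ψ hh ht, add_div, div_self hh.ne',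
    ← intervalIntegral.integral_add_adjacent_intervals (hint (t + h) h 0 1)
      (hint (t + h) h 1 (t / h + 1)), ← hshift]
  simp only [sub_mul]
  rw [intervalIntegral.integral_sub hshift_int (hint t h 0 (t / h))]
  ring

theorem tendsto_integral_mul_comp_sub_mul {k ψ : ℝ → ℝ}
    (hk : IntegrableOn k (Set.Ioi 0) volume) (hψ : Continuous ψ) {M : ℝ} (hM : ∀ y, |ψ y| ≤ M)
    {t : ℝ} (ht : 0 < t) :
    Tendsto (fun h : ℝ => ∫ v in (0 : ℝ)..t / h, k v * ψ (t - h * v))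
      (nhdsWithin 0 (Set.Ioi 0)) (nhds ((∫ v in Set.Ioi (0 : ℝ), k v) * ψ t)) := by
  rw [← integral_mul_const]
  have hind : ∀ᶠ h : ℝ in nhdsWithin 0 (Set.Ioi 0),
      ∫ v in Set.Ioi (0 : ℝ), (Set.Iic (t / h)).indicator (fun v => k v * ψ (t - h * v)) v =
        ∫ v in (0 : ℝ)..t / h, k v * ψ (t - h * v) := by
    filter_upwards [self_mem_nhdsWithin] with h hh
    rw [intervalIntegral.integral_of_le (div_pos ht hh).le,
      setIntegral_indicator measurableSet_Iic, Set.Ioi_inter_Iic]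
  refine Tendsto.congr' hind ?_
  refine tendsto_integral_filter_of_dominated_convergence (fun v => |k v| * M) ?_ ?_
    (hk.abs.mul_const M) ?_
  · refine Eventually.of_forall fun h => ?_
    refine AEStronglyMeasurable.indicator ?_ measurableSet_Iic
    exact hk.aestronglyMeasurable.mul
      (by fun_prop : Continuous fun v => ψ (t - h * v)).aestronglyMeasurable
  · refine Eventually.of_forall fun h => Eventually.of_forall fun v => ?_
    refine (norm_indicator_le_norm_self _ _).trans ?_
    rw [norm_mul]
    exact mul_le_mul_of_nonneg_left (hM _) (norm_nonneg _)
  · filter_upwards [ae_restrict_mem measurableSet_Ioi] with v hv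
    have hv : 0 < v := hv
    have hmem : ∀ᶠ h : ℝ in nhdsWithin 0 (Set.Ioi 0),
        k v * ψ (t - h * v) = (Set.Iic (t / h)).indicator (fun v => k v * ψ (t - h * v)) v := by
      filter_upwards [Ioo_mem_nhdsGT (div_pos ht hv)] with h hh
      rw [Set.indicator_of_mem]
      exact (le_div_comm₀ hh.1 hv).1 hh.2.le
    refine Tendsto.congr' hmem ?_
    have hc : Continuous fun h => k v * ψ (t - h * v) := by fun_prop
    simpa using (hc.tendsto 0).mono_left nhdsWithin_le_nhds

theorem tendsto_integral_rpow_mul_comp {α : ℝ} (hα : 0 < α) {ψ : ℝ → ℝ} (hψ : Continuous ψ)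
    {M : ℝ} (hM : ∀ y, |ψ y| ≤ M) (t : ℝ) :
    Tendsto (fun h : ℝ => ∫ u in (0 : ℝ)..1, u ^ (α - 1) * ψ (t + h - h * u))
      (nhdsWithin 0 (Set.Ioi 0)) (nhds ((∫ u in (0 : ℝ)..1, u ^ (α - 1)) * ψ t)) := by
  have hint : IntervalIntegrable (fun u : ℝ => u ^ (α - 1)) volume 0 1 :=
    intervalIntegral.intervalIntegrable_rpow' (by linarith)
  rw [← intervalIntegral.integral_mul_const]
  refine intervalIntegral.tendsto_integral_filter_of_dominated_convergence
    (fun u => |u ^ (α - 1)| * M) ?_ ?_ (hint.abs.mul_const M) ?_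
  · exact Eventually.of_forall fun h =>
      (intervalIntegrable_rpow_mul_comp hα hψ (t + h) h 0 1).def'.aestronglyMeasurable
  · refine Eventually.of_forall fun h => Eventually.of_forall fun u _ => ?_
    rw [norm_mul]
    exact mul_le_mul_of_nonneg_left (hM _) (norm_nonneg _)
  · refine Eventually.of_forall fun u _ => ?_
    have hc : Continuous fun h => u ^ (α - 1) * ψ (t + h - h * u) := by fun_prop
    simpa using (hc.tendsto 0).mono_left nhdsWithin_le_nhds

theorem riemannLiouville_congr (α : ℝ) {φ ψ : ℝ → ℝ} {x : ℝ} (hx : 0 ≤ x)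
    (h : Set.EqOn φ ψ (Set.Icc 0 x)) : riemannLiouville α φ x = riemannLiouville α ψ x := by
  unfold riemannLiouville
  congr 1
  refine intervalIntegral.integral_congr fun y hy => ?_
  rw [Set.uIcc_of_le hx] at hy
  simp only [h hy]

theorem tendsto_rpow_neg_mul_riemannLiouville_sub {α : ℝ} (hα : α ∈ Set.Ioo (0 : ℝ) 1)
    {ψ : ℝ → ℝ} (hψ : Continuous ψ) {M : ℝ} (hM : ∀ y, |ψ y| ≤ M) {t : ℝ} (ht : 0 < t) :
    Tendsto
      (fun h : ℝ => h ^ (-α) * (riemannLiouville α ψ (t + h) - riemannLiouville α ψ t))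
      (nhdsWithin 0 (Set.Ioi 0))
      (nhds ((1 / Real.Gamma α) *
        ((∫ y in Set.Ioi (0 : ℝ), ((y + 1) ^ (α - 1) - y ^ (α - 1))) +
          ∫ y in (0 : ℝ)..1, y ^ (α - 1)) * ψ t)) := by
  have hlim := ((tendsto_integral_mul_comp_sub_mul (integrableOn_rpow_add_one_sub_rpow hα)
    hψ hM ht).add (tendsto_integral_rpow_mul_comp hα.1 hψ hM t)).const_mul (1 / Real.Gamma α)
  rw [← add_mul, ← mul_assoc] at hlim
  refine Tendsto.congr' ?_ hlim
  filter_upwards [self_mem_nhdsWithin] with h hh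
  rw [← rpow_neg_mul_integral_sub_integral hα.1 hψ hh ht.le]
  unfold riemannLiouville
  ring

/-- for `α ∈ (0,1)`, `φ` continuous on `[0,T]` and `t ∈ (0,T)`,
the integral `∫₀^∞ ((y+1)^{α-1} - y^{α-1}) dy` is absolutely convergent, and
`h^{-α} (I^α_{0+}φ(t+h) - I^α_{0+}φ(t)) → c_α · φ(t)` as `h ↓ 0`, where
`c_α = (1/Γ(α)) (∫₀^∞ ((y+1)^{α-1} - y^{α-1}) dy + ∫₀^1 y^{α-1} dy)`. -/
theorem stmt_12 (α T t : ℝ) (hα : α ∈ Set.Ioo (0 : ℝ) 1) (hT : 0 < T)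
    (φ : ℝ → ℝ) (hφ : ContinuousOn φ (Set.Icc 0 T)) (ht : t ∈ Set.Ioo 0 T) :
    IntegrableOn (fun y : ℝ => (y + 1) ^ (α - 1) - y ^ (α - 1)) (Set.Ioi 0) volume ∧
    Tendsto
      (fun h : ℝ => h ^ (-α) * (riemannLiouville α φ (t + h) - riemannLiouville α φ t))
      (nhdsWithin 0 (Set.Ioi 0))
      (nhds ((1 / Real.Gamma α) *
        ((∫ y in Set.Ioi (0 : ℝ), ((y + 1) ^ (α - 1) - y ^ (α - 1))) +
          ∫ y in (0 : ℝ)..1, y ^ (α - 1)) * φ t)) := by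
  refine ⟨integrableOn_rpow_add_one_sub_rpow hα, ?_⟩
  obtain ⟨M, hM⟩ := isCompact_Icc.exists_bound_of_continuousOn hφ
  set ψ : ℝ → ℝ := Set.IccExtend hT.le ((Set.Icc 0 T).domRestrict φ) with hψ_def
  have hψ : Continuous ψ := hφ.domRestrict.Icc_extend'
  have hψM : ∀ y, |ψ y| ≤ M := fun y => hM _ (Set.projIcc 0 T hT.le y).2
  have heq : Set.EqOn φ ψ (Set.Icc 0 T) := fun y hy => by
    rw [hψ_def, Set.IccExtend_of_mem _ _ hy, Set.domRestrict_apply]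
  have hRL : ∀ x ∈ Set.Icc 0 T, riemannLiouville α φ x = riemannLiouville α ψ x := fun x hx =>
    riemannLiouville_congr α hx.1 (heq.mono (Set.Icc_subset_Icc_right hx.2))
  rw [heq (Set.Ioo_subset_Icc_self ht)]
  refine Tendsto.congr' ?_ (tendsto_rpow_neg_mul_riemannLiouville_sub hα hψ hψM ht.1)
  filter_upwards [Ioo_mem_nhdsGT (sub_pos.2 ht.2)] with h hh
  rw [hRL t (Set.Ioo_subset_Icc_self ht),
    hRL (t + h) ⟨by linarith [ht.1, hh.1], by linarith [hh.2]⟩]
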